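/- arXiv:2408.15515 — 8 statements merged into one kernel-verified Lean document; each statement's English description precedes it below -/
import Mathlib

section
/- Let N ≥ 1 and a, b : Fin N → (ZMod 2)². If the number of anticommuting positions of the pair (a, b) is even, then G a * G b = G b * G a; if it is odd, then G a * G b = -(G b * G a). -/
open Matrix

/-- Pauli matrices indexed by GF(4) identified with (ZMod 2)². -/
noncomputable def pauli (a : ZMod 2 × ZMod 2) : Matrix (Fin 2) (Fin 2) ℂ :=
  if a = (0, 0) then 1
  else if a = (1, 0) then !![0, 1; 1, 0]
  else if a = (0, 1) then !![0, -Complex.I; Complex.I, 0]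
  else !![1, 0; 0, -1]

/-- The N-qubit Pauli word σ_{a 0} ⊗ ⋯ ⊗ σ_{a (N-1)}. -/
noncomputable def pauliWord {N : ℕ} (a : Fin N → ZMod 2 × ZMod 2) :
    Matrix (Fin N → Fin 2) (Fin N → Fin 2) ℂ :=
  Matrix.of fun x y => ∏ i, pauli (a i) (x i) (y i)

/-- The number of anticommuting positions of the pair of rows (a, b):
positions where not (a i = 0 or b i = 0 or a i = b i). -/
def anticommCount {N : ℕ} (a b : Fin N → ZMod 2 × ZMod 2) : ℕ :=
  (Finset.univ.filter fun i => ¬(a i = 0 ∨ b i = 0 ∨ a i = b i)).card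

theorem pauli_mul_comm (p q : ZMod 2 × ZMod 2) :
    pauli p * pauli q =
      (if ¬(p = 0 ∨ q = 0 ∨ p = q) then (-1 : ℂ) else 1) • (pauli q * pauli p) := by
  have cases_four : ∀ r : ZMod 2 × ZMod 2,
      r = (0, 0) ∨ r = (1, 0) ∨ r = (0, 1) ∨ r = (1, 1) := by decide
  rcases cases_four p with rfl | rfl | rfl | rfl <;>
    rcases cases_four q with rfl | rfl | rfl | rfl <;>
    simp [pauli]

theorem pauliWord_mul_apply {N : ℕ} (a b : Fin N → ZMod 2 × ZMod 2) (x y : Fin N → Fin 2) :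
    (pauliWord a * pauliWord b) x y = ∏ i, (pauli (a i) * pauli (b i)) (x i) (y i) := by
  simp only [Matrix.mul_apply, pauliWord, Matrix.of_apply, ← Finset.prod_mul_distrib]
  rw [Finset.prod_univ_sum, Fintype.piFinset_univ]

theorem pauliWord_mul_comm {N : ℕ} (a b : Fin N → ZMod 2 × ZMod 2) :
    pauliWord a * pauliWord b =
      (-1 : ℂ) ^ anticommCount a b • (pauliWord b * pauliWord a) := by
  ext x y
  rw [Matrix.smul_apply, pauliWord_mul_apply, pauliWord_mul_apply, smul_eq_mul, anticommCount,
    ← Finset.prod_const, Finset.prod_filter, ← Finset.prod_mul_distrib]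
  refine Finset.prod_congr rfl fun i _ => ?_
  rw [pauli_mul_comm (a i) (b i), Matrix.smul_apply, smul_eq_mul]

theorem stmt_2 (N : ℕ) (hN : 1 ≤ N) (a b : Fin N → ZMod 2 × ZMod 2) :
    (Even (anticommCount a b) → pauliWord a * pauliWord b = pauliWord b * pauliWord a) ∧
    (Odd (anticommCount a b) → pauliWord a * pauliWord b = -(pauliWord b * pauliWord a)) := by
  constructor <;> intro h
  · rw [pauliWord_mul_comm, h.neg_one_pow, one_smul]
  · rw [pauliWord_mul_comm, h.neg_one_pow, neg_one_smul]
end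

section
/- Let a : Fin m → Fin N → (ZMod 2)² be a family of generator rows satisfying the independence condition: for every ε : Fin m → ZMod 2 with ε ≠ 0, the row ∑ i, ε i • a i (pointwise sum in (ZMod 2)² over the selected generators) is not the zero row. Then the matrix ρ = (2^N : ℂ)⁻¹ • P, where P is the ordered product (1 + G (a 0)) * (1 + G (a 1)) * ⋯ * (1 + G (a (m-1))), has trace 1. -/
open Matrix

theorem pauli_zero_zero : pauli (0, 0) = 1 := by simp [pauli]

theorem pauli_one_zero : pauli (1, 0) = !![0, 1; 1, 0] := by simp [pauli]

theorem pauli_zero_one : pauli (0, 1) = !![0, -Complex.I; Complex.I, 0] := by simp [pauli]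

theorem pauli_one_one : pauli (1, 1) = !![1, 0; 0, -1] := by simp [pauli]

theorem zmod_two_prod_cases (a : ZMod 2 × ZMod 2) :
    a = (0, 0) ∨ a = (1, 0) ∨ a = (0, 1) ∨ a = (1, 1) := by
  revert a
  decide

theorem trace_pauli_eq_zero {a : ZMod 2 × ZMod 2} (ha : a ≠ 0) : (pauli a).trace = 0 := by
  rcases zmod_two_prod_cases a with rfl | rfl | rfl | rfl
  · exact absurd rfl ha
  · simp [pauli_one_zero, Matrix.trace_fin_two]
  · simp [pauli_zero_one, Matrix.trace_fin_two]
  · simp [pauli_one_one, Matrix.trace_fin_two]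

/-- Pauli matrices multiply as `(ZMod 2)²` adds, up to a phase. -/
theorem exists_pauli_mul_eq_smul (a b : ZMod 2 × ZMod 2) :
    ∃ c : ℂ, pauli a * pauli b = c • pauli (a + b) := by
  have two : (1 : ZMod 2) + 1 = 0 := rfl
  suffices ∃ c ∈ ({1, Complex.I, -Complex.I} : Set ℂ), pauli a * pauli b = c • pauli (a + b) by
    obtain ⟨c, -, hc⟩ := this
    exact ⟨c, hc⟩
  rcases zmod_two_prod_cases a with rfl | rfl | rfl | rfl <;>
    rcases zmod_two_prod_cases b with rfl | rfl | rfl | rfl <;>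
    simp [two, pauli_zero_zero, pauli_one_zero, pauli_zero_one, pauli_one_one,
      Matrix.one_fin_two]

section PauliWord

variable {N : ℕ}

theorem trace_pauliWord (a : Fin N → ZMod 2 × ZMod 2) :
    (pauliWord a).trace = ∏ i, (pauli (a i)).trace := by
  simp only [Matrix.trace, Matrix.diag_apply, pauliWord, Matrix.of_apply]
  rw [Finset.prod_univ_sum, Fintype.piFinset_univ]

theorem trace_pauliWord_eq_zero {a : Fin N → ZMod 2 × ZMod 2} (ha : a ≠ 0) :
    (pauliWord a).trace = 0 := by
  obtain ⟨i, hi⟩ := Function.ne_iff.mp ha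
  rw [trace_pauliWord]
  exact Finset.prod_eq_zero (Finset.mem_univ i) (trace_pauli_eq_zero hi)

theorem exists_pauliWord_mul_eq_smul (a b : Fin N → ZMod 2 × ZMod 2) :
    ∃ c : ℂ, pauliWord a * pauliWord b = c • pauliWord (a + b) := by
  choose c hc using fun i => exists_pauli_mul_eq_smul (a i) (b i)
  refine ⟨∏ i, c i, ?_⟩
  ext x y
  simp only [Matrix.mul_apply, pauliWord, Matrix.of_apply, Matrix.smul_apply, smul_eq_mul,
    ← Finset.prod_mul_distrib, Pi.add_apply]
  rw [← Fintype.piFinset_univ, ← Finset.prod_univ_sum (fun _ => Finset.univ)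
    fun i j => pauli (a i) (x i) j * pauli (b i) j (y i)]
  refine Finset.prod_congr rfl fun i _ => ?_
  rw [← Matrix.mul_apply, hc, Matrix.smul_apply, smul_eq_mul]

theorem trace_pauliWord_mul_prod_eq_zero {m : ℕ} (a : Fin m → Fin N → ZMod 2 × ZMod 2)
    (b : Fin N → ZMod 2 × ZMod 2) (h : ∀ ε : Fin m → ZMod 2, b + ∑ i, ε i • a i ≠ 0) :
    (pauliWord b * (List.ofFn fun i => 1 + pauliWord (a i)).prod).trace = 0 := by
  induction m generalizing b with
  | zero => simpa using trace_pauliWord_eq_zero (by simpa using h 0)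
  | succ m ih =>
    obtain ⟨c, hc⟩ := exists_pauliWord_mul_eq_smul b (a 0)
    rw [List.ofFn_succ, List.prod_cons, ← mul_assoc, mul_add, mul_one, hc, add_mul,
      Matrix.smul_mul, Matrix.trace_add, Matrix.trace_smul,
      ih (fun i => a i.succ) b fun ε => by simpa [Fin.sum_univ_succ] using h (Fin.cons 0 ε),
      ih (fun i => a i.succ) (b + a 0) fun ε => by
        simpa [Fin.sum_univ_succ, add_assoc] using h (Fin.cons 1 ε)]
    simp

theorem trace_prod_one_add_pauliWord {m : ℕ} (a : Fin m → Fin N → ZMod 2 × ZMod 2)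
    (h : ∀ ε : Fin m → ZMod 2, ε ≠ 0 → ∑ i, ε i • a i ≠ 0) :
    (List.ofFn fun i => 1 + pauliWord (a i)).prod.trace = 2 ^ N := by
  induction m with
  | zero => simp
  | succ m ih =>
    rw [List.ofFn_succ, List.prod_cons, add_mul, one_mul, Matrix.trace_add,
      trace_pauliWord_mul_prod_eq_zero (fun i => a i.succ) (a 0), add_zero]
    · refine ih (fun i => a i.succ) fun ε hε => ?_
      have hcons : (Fin.cons 0 ε : Fin (m + 1) → ZMod 2) ≠ 0 := fun h0 =>
        hε (funext fun i => by simpa using congrFun h0 i.succ)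
      simpa [Fin.sum_univ_succ] using h _ hcons
    · intro ε
      have hcons : (Fin.cons 1 ε : Fin (m + 1) → ZMod 2) ≠ 0 := fun h0 => by
        simpa using congrFun h0 0
      simpa [Fin.sum_univ_succ] using h _ hcons

end PauliWord

theorem stmt_4 (N m : ℕ) (hN : 1 ≤ N) (hm : 1 ≤ m)
    (a : Fin m → Fin N → ZMod 2 × ZMod 2)
    (hindep : ∀ ε : Fin m → ZMod 2, ε ≠ 0 → (∑ i, ε i • a i) ≠ 0)
    (P : Matrix (Fin N → Fin 2) (Fin N → Fin 2) ℂ)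
    (hP : P = (List.ofFn fun i => 1 + pauliWord (a i)).prod)
    (ρ : Matrix (Fin N → Fin 2) (Fin N → Fin 2) ℂ)
    (hρ : ρ = (2 ^ N : ℂ)⁻¹ • P) :
    Matrix.trace ρ = 1 := by
  rw [hρ, hP, Matrix.trace_smul, trace_prod_one_add_pauliWord a hindep, smul_eq_mul]
  exact inv_mul_cancel₀ (pow_ne_zero N two_ne_zero)
end

section
/- Let 1 ≤ k < N, d ≥ 1, s ≥ 1, m ≥ 1 and let B : Fin m → Fin s → (Fin N → Fin d) be blocks of rows such that: (i) within each block distinct rows have Hamming distance at least k + 1, i.e. for all i and all τ ≠ τ', hammingDist (B i τ) (B i τ') ≥ k + 1; (ii) the union of all blocks is an orthogonal array of strength k, i.e. for every S ⊆ Fin N with S.card = k and every t : Fin N → Fin d, the number of pairs (i, τ) with A i τ j = t j for all j ∈ S, multiplied by d^k, equals m * s. Define φ i = (Real.sqrt s : ℂ)⁻¹ • ∑ τ, e (B i τ) and ρ = (m : ℂ)⁻¹ • ∑ i, vecMulVec (φ i) (star (φ i)). Then ρ is k-uniform: for every S ⊆ Fin N with S.card = k, the reduced matrix ρ_S equals (d^k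 : ℂ)⁻¹ • 1. -/
open Matrix

/-- Standard basis vector: e z w = if w = z then 1 else 0. -/
noncomputable def stdBasis {N d : ℕ} (z : Fin N → Fin d) : (Fin N → Fin d) → ℂ :=
  fun w => if w = z then 1 else 0

/-- Merge a function on S and a function on its complement into a function on Fin N. -/
def mergeFn {N d : ℕ} (S : Finset (Fin N)) (u : {j // j ∈ S} → Fin d)
    (w : {j // j ∉ S} → Fin d) : Fin N → Fin d :=
  fun j => if h : j ∈ S then u ⟨j, h⟩ else w ⟨j, h⟩

/-- The reduced matrix (partial trace over the complement of S). -/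
noncomputable def reduceMatrix {N d : ℕ} (ρ : Matrix (Fin N → Fin d) (Fin N → Fin d) ℂ)
    (S : Finset (Fin N)) :
    Matrix ({j // j ∈ S} → Fin d) ({j // j ∈ S} → Fin d) ℂ :=
  Matrix.of fun u v => ∑ w : {j // j ∉ S} → Fin d, ρ (mergeFn S u w) (mergeFn S v w)

theorem mergeFn_eq_iff {N d : ℕ} (S : Finset (Fin N)) (u : {j // j ∈ S} → Fin d)
    (w : {j // j ∉ S} → Fin d) (x : Fin N → Fin d) :
    mergeFn S u w = x ↔ (∀ j : {j // j ∈ S}, x j = u j) ∧ w = fun j : {j // j ∉ S} => x j := by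
  constructor
  · rintro rfl
    refine ⟨fun j => ?_, funext fun j => ?_⟩ <;> simp [mergeFn, j.2]
  · rintro ⟨hu, rfl⟩
    funext j
    by_cases h : j ∈ S
    · simp [mergeFn, h, hu ⟨j, h⟩]
    · simp [mergeFn, h]

theorem mergeFn_left_injective {N d : ℕ} (S : Finset (Fin N)) (w : {j // j ∉ S} → Fin d) :
    Function.Injective fun u => mergeFn S u w := by
  intro u v h
  funext j
  simpa [mergeFn, j.2] using congrFun h j

theorem hammingDist_mergeFn_le {N d : ℕ} (S : Finset (Fin N)) (u v : {j // j ∈ S} → Fin d)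
    (w : {j // j ∉ S} → Fin d) :
    hammingDist (mergeFn S u w) (mergeFn S v w) ≤ S.card := by
  refine Finset.card_le_card fun j hj => ?_
  by_contra h
  exact (Finset.mem_filter.mp hj).2 (by simp [mergeFn, h])

/-- Rows at distance greater than `S.card` contribute no coherences to the reduced matrix. -/
theorem sum_stdBasis_mul_sum_stdBasis_mergeFn {N d : ℕ} {ι : Type*} [Fintype ι]
    (b : ι → Fin N → Fin d) (S : Finset (Fin N))
    (hb : ∀ τ τ', τ ≠ τ' → S.card < hammingDist (b τ) (b τ'))
    (u v : {j // j ∈ S} → Fin d) (w : {j // j ∉ S} → Fin d) :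
    (∑ τ, stdBasis (b τ) (mergeFn S u w)) * ∑ τ, stdBasis (b τ) (mergeFn S v w) =
      if u = v then ∑ τ, stdBasis (b τ) (mergeFn S u w) else 0 := by
  classical
  have hoff : ∀ τ τ', τ ≠ τ' →
      stdBasis (b τ) (mergeFn S u w) * stdBasis (b τ') (mergeFn S v w) = 0 := by
    intro τ τ' hne
    by_contra h
    simp only [_root_.stdBasis, mul_ite, mul_one, mul_zero, ite_eq_right_iff, not_forall] at h
    obtain ⟨hv, hu, -⟩ := h
    have := hb τ τ' hne
    rw [← hu, ← hv] at this
    exact absurd (hammingDist_mergeFn_le S u v w) (not_le.mpr this)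
  have hdiag : ∀ τ, stdBasis (b τ) (mergeFn S u w) * stdBasis (b τ) (mergeFn S v w) =
      if u = v then stdBasis (b τ) (mergeFn S u w) else 0 := by
    intro τ
    split_ifs with huv
    · subst huv
      simp [_root_.stdBasis]
    · by_contra h
      simp only [_root_.stdBasis, mul_ite, mul_one, mul_zero, ite_eq_right_iff, not_forall] at h
      obtain ⟨hv, hu, -⟩ := h
      exact huv (mergeFn_left_injective S w (hu.trans hv.symm))
  rw [Finset.sum_mul_sum]
  calc _ = ∑ τ, stdBasis (b τ) (mergeFn S u w) * stdBasis (b τ) (mergeFn S v w) :=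
        Finset.sum_congr rfl fun τ _ =>
          Finset.sum_eq_single τ (fun τ' _ h => hoff τ τ' h.symm) (by simp)
    _ = _ := by
        simp only [hdiag]
        split_ifs <;> simp

theorem sum_stdBasis_mergeFn {N d : ℕ} (S : Finset (Fin N)) (u : {j // j ∈ S} → Fin d)
    (x : Fin N → Fin d) :
    ∑ w, stdBasis x (mergeFn S u w) = if ∀ j : {j // j ∈ S}, x j = u j then 1 else 0 := by
  simp only [_root_.stdBasis, mergeFn_eq_iff]
  split_ifs with h <;> simp only [h, false_and, if_false] <;> simp

theorem stmt_11 (d s m N k : ℕ) (hk : 1 ≤ k) (hkN : k < N) (hd : 1 ≤ d)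
    (hs : 1 ≤ s) (hm : 1 ≤ m)
    (B : Fin m → Fin s → (Fin N → Fin d))
    (hdist : ∀ i : Fin m, ∀ τ τ' : Fin s, τ ≠ τ' → k + 1 ≤ hammingDist (B i τ) (B i τ'))
    (hOA : ∀ S : Finset (Fin N), S.card = k → ∀ t : Fin N → Fin d,
      ((Finset.univ : Finset (Fin m × Fin s)).filter
        fun p => ∀ j ∈ S, B p.1 p.2 j = t j).card * d ^ k = m * s)
    (φ : Fin m → (Fin N → Fin d) → ℂ)
    (hφ : ∀ i, φ i = (Real.sqrt s : ℂ)⁻¹ • ∑ τ, stdBasis (B i τ))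
    (ρ : Matrix (Fin N → Fin d) (Fin N → Fin d) ℂ)
    (hρ : ρ = (m : ℂ)⁻¹ • ∑ i, Matrix.vecMulVec (φ i) (star (φ i))) :
    ∀ S : Finset (Fin N), S.card = k → reduceMatrix ρ S = ((d : ℂ) ^ k)⁻¹ • 1 := by
  intro S hS
  have hd' : (d : ℂ) ≠ 0 := by exact_mod_cast (by omega : d ≠ 0)
  have hs' : (s : ℂ) ≠ 0 := by exact_mod_cast (by omega : s ≠ 0)
  have hm' : (m : ℂ) ≠ 0 := by exact_mod_cast (by omega : m ≠ 0)
  have hsqrt : (Real.sqrt s : ℂ)⁻¹ * (Real.sqrt s : ℂ)⁻¹ = (s : ℂ)⁻¹ := by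
    rw [← mul_inv, ← Complex.ofReal_mul, Real.mul_self_sqrt (Nat.cast_nonneg s),
      Complex.ofReal_natCast]
  have hstar : ∀ i y, star (φ i y) = φ i y := by
    intro i y
    simp [hφ, _root_.stdBasis]
  have hentry : ∀ i (u v : {j // j ∈ S} → Fin d) w,
      φ i (mergeFn S u w) * φ i (mergeFn S v w) =
        (s : ℂ)⁻¹ * if u = v then ∑ τ, stdBasis (B i τ) (mergeFn S u w) else 0 := by
    intro i u v w
    rw [← sum_stdBasis_mul_sum_stdBasis_mergeFn (B i) S
      (fun τ τ' h => by have := hdist i τ τ' h; omega) u v w, hφ, ← hsqrt]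
    simp only [Pi.smul_apply, Finset.sum_apply, smul_eq_mul]
    ring
  ext u v
  have hreduce : reduceMatrix ρ S u v =
      (m : ℂ)⁻¹ * ∑ w, ∑ i, φ i (mergeFn S u w) * φ i (mergeFn S v w) := by
    simp [reduceMatrix, hρ, Matrix.sum_apply, Matrix.vecMulVec_apply, hstar, Finset.mul_sum,
      -RCLike.star_def]
  rw [hreduce]
  simp only [hentry, Matrix.smul_apply, Matrix.one_apply, smul_eq_mul]
  by_cases huv : u = v
  · have hcount : ∑ w, ∑ i, ∑ τ, stdBasis (B i τ) (mergeFn S u w) =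
        ((Finset.univ.filter fun p : Fin m × Fin s =>
          ∀ j ∈ S, B p.1 p.2 j = mergeFn S u (fun _ => ⟨0, hd⟩) j).card : ℂ) := by
      simp only [← Fintype.sum_prod_type' fun i τ => stdBasis (B i τ) _]
      rw [Finset.sum_comm]
      simp only [sum_stdBasis_mergeFn, Finset.sum_boole]
      congr 2
      ext p
      simp +contextual [mergeFn]
    have hcard := congrArg (Nat.cast : ℕ → ℂ) (hOA S hS (mergeFn S u fun _ => ⟨0, hd⟩))
    push_cast at hcard
    simp only [huv, if_true, ← Finset.mul_sum] at hcount ⊢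
    rw [hcount]
    rw [huv] at hcard
    field_simp
    linear_combination hcard
  · simp [huv]
end

section
/- Let 1 ≤ k ≤ N, d ≥ 1, and let D : Fin r → Fin N → ZMod d be a difference scheme of strength k: for every injective c : Fin k → Fin N and every w : Fin k → ZMod d with w 0 = 0, the number of rows i with D i (c l) = D i (c 0) + w l for all l, multiplied by d^(k-1), equals r. Then the array E : Fin r × ZMod d → Fin N → ZMod d defined by E (i, λ) j = D i j + λ is an orthogonal array of strength k: for every injective c : Fin k → Fin N and every target t : Fin k → ZMod d, the number of pairs (i, λ) with D i (c l) + λ = t l for all l, multiplied by d^k, equals r * d. -/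
theorem stmt_12 (r N d k : ℕ) (hk : 1 ≤ k) (hkN : k ≤ N) (hd : 1 ≤ d) [NeZero d]
    (D : Fin r → Fin N → ZMod d)
    (hD : ∀ c : Fin k → Fin N, Function.Injective c →
      ∀ w : Fin k → ZMod d, w ⟨0, hk⟩ = 0 →
        (Finset.univ.filter fun i : Fin r =>
          ∀ l, D i (c l) = D i (c ⟨0, hk⟩) + w l).card * d ^ (k - 1) = r) :
    ∀ c : Fin k → Fin N, Function.Injective c → ∀ t : Fin k → ZMod d,
      ((Finset.univ : Finset (Fin r × ZMod d)).filter
        fun p => ∀ l, D p.1 (c l) + p.2 = t l).card * d ^ k = r * d := by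
  intro c hc t
  have key := hD c hc (fun l => t l - t ⟨0, hk⟩) (sub_self _)
  have card_eq : ((Finset.univ : Finset (Fin r × ZMod d)).filter
        fun p => ∀ l, D p.1 (c l) + p.2 = t l).card =
      (Finset.univ.filter fun i : Fin r =>
        ∀ l, D i (c l) = D i (c ⟨0, hk⟩) + (t l - t ⟨0, hk⟩)).card := by
    refine Finset.card_nbij' Prod.fst (fun i => (i, t ⟨0, hk⟩ - D i (c ⟨0, hk⟩))) ?_ ?_ ?_ ?_
    · intro p hp
      simp only [Finset.coe_filter, Finset.mem_univ, true_and, Set.mem_ofPred_eq] at hp ⊢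
      intro l
      rw [← hp l, ← hp ⟨0, hk⟩]
      ring
    · intro i hi
      simp only [Finset.coe_filter, Finset.mem_univ, true_and, Set.mem_ofPred_eq] at hi ⊢
      intro l
      rw [hi l]
      ring
    · intro p hp
      simp only [Finset.coe_filter, Finset.mem_univ, true_and, Set.mem_ofPred_eq] at hp
      refine Prod.ext rfl ?_
      simp [← hp ⟨0, hk⟩]
    · intro i _
      rfl
  rw [card_eq, ← pow_sub_one_mul (Nat.one_le_iff_ne_zero.mp hk) d, ← mul_assoc]
  exact congrArg (· * d) key
end

section
/- Let N ≥ 2, 1 ≤ k ≤ N, d ≥ 1 and let A : Fin r → Fin Nize → Fin d (with N the number of columns) be an orthogonal array of strength k: for every S ⊆ Fin N with S.card = k and every t : Fin N → Fin d, the number of rows i with A i j = t j for all j ∈ S, multiplied by d^k, equals r. Fix a symbol s : Fin d and let R = {i // A i 0 = s} with restricted array A' : R → Fin (N-1) → Fin d, A' i j = A i j.succ. Then: (i) the cardinality of R times d equals r; (ii) A' is an orthogonal array of strength k - 1 on N - 1 columns; (iii) for distinct i, i' ∈ R, hammingDist (A' i) (A' i') = hammingDist (A i.val) (A i'.val); in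 particular if all distinct rows of A have Hamming distance at least k + 1, the same holds for A'. -/
/-- The number of tuples agreeing with a given tuple on a set of coordinates. -/
theorem card_filter_eqOn {κ α : Type*} [Fintype κ] [DecidableEq κ] [Fintype α] [DecidableEq α]
    (S : Finset κ) (a : κ → α) :
    (Finset.univ.filter fun t : κ → α => ∀ j ∈ S, a j = t j).card
      = Fintype.card α ^ (Fintype.card κ - S.card) := by
  have h : (Finset.univ.filter fun t : κ → α => ∀ j ∈ S, a j = t j)
      = Fintype.piFinset fun j => if j ∈ S then {a j} else Finset.univ := by
    ext t
    simp only [Finset.mem_filter, Finset.mem_univ, true_and, Fintype.mem_piFinset]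
    refine forall_congr' fun j => ?_
    by_cases hj : j ∈ S <;> simp [hj, eq_comm]
  rw [h, Fintype.card_piFinset, ← Finset.card_compl, ← Finset.prod_const,
    ← Finset.prod_mul_prod_compl S, Finset.prod_eq_one, one_mul]
  · refine Finset.prod_congr rfl fun j hj => ?_
    rw [if_neg (Finset.mem_compl.mp hj), Finset.card_univ]
  · intro j hj
    rw [if_pos hj, Finset.card_singleton]

/-- If every pattern on the columns `S` occurs in the same number `c` of rows, then the number of
rows is `c` times the number of patterns. -/
theorem mul_card_pow_eq_card_of_card_filter_eq {ι κ α : Type*} [Fintype ι] [Fintype κ]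
    [DecidableEq κ] [Fintype α] [Nonempty α] [DecidableEq α] (X : ι → κ → α) (S : Finset κ) (c : ℕ)
    (hc : ∀ t : κ → α, (Finset.univ.filter fun i => ∀ j ∈ S, X i j = t j).card = c) :
    c * Fintype.card α ^ S.card = Fintype.card ι := by
  have h := Finset.sum_card_bipartiteAbove_eq_sum_card_bipartiteBelow
    (s := (Finset.univ : Finset ι)) (t := (Finset.univ : Finset (κ → α)))
    (fun i t => ∀ j ∈ S, X i j = t j)
  simp only [Finset.bipartiteAbove, Finset.bipartiteBelow, card_filter_eqOn, hc,
    Finset.sum_const, Finset.card_univ, smul_eq_mul, Fintype.card_fun] at h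
  refine Nat.eq_of_mul_eq_mul_right
    (pow_pos Fintype.card_pos (Fintype.card κ - S.card) : 0 < Fintype.card α ^ _) ?_
  rw [h, mul_assoc, ← pow_add, Nat.add_sub_cancel' S.card_le_univ, mul_comm]

/-- Deleting a column on which two tuples agree preserves their Hamming distance. -/
theorem hammingDist_tail {n : ℕ} {α : Type*} [DecidableEq α] {x y : Fin (n + 1) → α}
    (h : x 0 = y 0) : hammingDist (Fin.tail x) (Fin.tail y) = hammingDist x y := by
  simp only [hammingDist, Fin.card_filter_univ_succ, h, Fin.tail, ne_eq, not_true_eq_false,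
    if_false]
  congr

/-- The rows of `A` starting with `s` whose tails match `t` on `S` are the rows of `A` matching
`Fin.cons s t` on the columns `0` and `S` shifted by one. -/
theorem card_filter_subtype_zero_eq {ι α : Type*} [Fintype ι] [DecidableEq α] {n : ℕ}
    (A : ι → Fin (n + 1) → α) (s : α) (S : Finset (Fin n)) (t : Fin n → α) :
    (Finset.univ.filter fun i : {i : ι // A i 0 = s} => ∀ j ∈ S, A i.val j.succ = t j).card
      = (Finset.univ.filter fun i : ι => ∀ j ∈ insert 0 (S.map (Fin.succEmb n)),
          A i j = (Fin.cons s t : Fin (n + 1) → α) j).card := by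
  rw [← Finset.card_map (Function.Embedding.subtype _)]
  congr 1
  ext i
  simp [and_comm]

/-- Restricting an orthogonal array to rows with a fixed symbol in the first column
and deleting that column yields an orthogonal array of strength k-1, preserving
Hamming distances between the selected rows.  (The array has n+1 ≥ 2 columns.) -/
theorem stmt_14 (r n d k : ℕ) (hn : 1 ≤ n) (hk : 1 ≤ k) (hkN : k ≤ n + 1) (hd : 1 ≤ d)
    (A : Fin r → Fin (n + 1) → Fin d)
    (hOA : ∀ S : Finset (Fin (n + 1)), S.card = k → ∀ t : Fin (n + 1) → Fin d,
      (Finset.univ.filter fun i : Fin r => ∀ j ∈ S, A i j = t j).card * d ^ k = r)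
    (s : Fin d)
    (A' : {i : Fin r // A i 0 = s} → Fin n → Fin d)
    (hA' : ∀ i j, A' i j = A i.val j.succ) :
    (Fintype.card {i : Fin r // A i 0 = s} * d = r) ∧
    (∀ S : Finset (Fin n), S.card = k - 1 → ∀ t : Fin n → Fin d,
      (Finset.univ.filter fun i : {i : Fin r // A i 0 = s} =>
        ∀ j ∈ S, A' i j = t j).card * d ^ (k - 1) = Fintype.card {i : Fin r // A i 0 = s}) ∧
    (∀ i i' : {i : Fin r // A i 0 = s}, i ≠ i' →
      hammingDist (A' i) (A' i') = hammingDist (A i.val) (A i'.val)) ∧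
    ((∀ i i' : Fin r, i ≠ i' → k + 1 ≤ hammingDist (A i) (A i')) →
      ∀ i i' : {i : Fin r // A i 0 = s}, i ≠ i' → k + 1 ≤ hammingDist (A' i) (A' i')) := by
  obtain rfl : A' = fun i => Fin.tail (A i.val) := funext fun i => funext (hA' i)
  have : Nonempty (Fin d) := ⟨s⟩
  have hcount : ∀ S : Finset (Fin n), S.card = k - 1 → ∀ t : Fin n → Fin d,
      (Finset.univ.filter fun i : {i : Fin r // A i 0 = s} =>
        ∀ j ∈ S, Fin.tail (A i.val) j = t j).card * d ^ k = r := by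
    intro S hS t
    have h := hOA (insert 0 (S.map (Fin.succEmb n)))
      (by rw [Finset.card_insert_of_notMem (by simp), Finset.card_map]; omega) (Fin.cons s t)
    rwa [← card_filter_subtype_zero_eq] at h
  have hstrength : ∀ S : Finset (Fin n), S.card = k - 1 → ∀ t : Fin n → Fin d,
      (Finset.univ.filter fun i : {i : Fin r // A i 0 = s} =>
        ∀ j ∈ S, Fin.tail (A i.val) j = t j).card * d ^ (k - 1)
          = Fintype.card {i : Fin r // A i 0 = s} := by
    intro S hS t
    have hconst := fun t' => Nat.eq_of_mul_eq_mul_right (pow_pos hd k)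
      ((hcount S hS t').trans (hcount S hS t).symm)
    have h := mul_card_pow_eq_card_of_card_filter_eq
      (fun i : {i : Fin r // A i 0 = s} => Fin.tail (A i.val)) S _ fun t' => by convert hconst t'
    rwa [Fintype.card_fin, hS] at h
  have hdist : ∀ i i' : {i : Fin r // A i 0 = s},
      hammingDist (Fin.tail (A i.val)) (Fin.tail (A i'.val)) = hammingDist (A i.val) (A i'.val) :=
    fun i i' => hammingDist_tail (i.2.trans i'.2.symm)
  refine ⟨?_, hstrength, fun i i' _ => hdist i i', fun h i i' hne => ?_⟩
  · obtain ⟨S, -, hS⟩ := Finset.exists_subset_card_eq (s := (Finset.univ : Finset (Fin n)))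
      (n := k - 1) (by rw [Finset.card_fin]; omega)
    rw [← hstrength S hS fun _ => s, mul_assoc, ← pow_succ, Nat.sub_add_cancel hk]
    exact hcount S hS _
  · exact (h _ _ (Subtype.coe_injective.ne hne)).trans_eq (hdist i i').symm
end

section
/- Let k' ≤ N, d ≥ 1 and let A : Fin (d^k') → Fin N → Fin d be an array such that any two distinct rows have Hamming distance at least N - k' + 1. Then A is an orthogonal array of strength k' and index one: for every S ⊆ Fin N with S.card = k' and every t : Fin N → Fin d, there is exactly one row i with A i j = t j for all j ∈ S. -/
/-- Tuples that agree on `S` differ in at most `card ι - card S` coordinates. -/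
theorem hammingDist_le_of_agree {ι α : Type*} [Fintype ι] [DecidableEq ι] [DecidableEq α]
    {S : Finset ι} {x y : ι → α} (h : ∀ j ∈ S, x j = y j) :
    hammingDist x y ≤ Fintype.card ι - S.card := by
  rw [← Finset.card_compl]
  refine Finset.card_le_card fun j hj => ?_
  rw [Finset.mem_compl]
  exact fun hjS => (Finset.mem_filter.mp hj).2 (h j hjS)

theorem stmt_15 (N d k' : ℕ) (hk' : k' ≤ N) (hd : 1 ≤ d)
    (A : Fin (d ^ k') → Fin N → Fin d)
    (hdist : ∀ i i', i ≠ i' → N - k' + 1 ≤ hammingDist (A i) (A i')) :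
    ∀ S : Finset (Fin N), S.card = k' → ∀ t : Fin N → Fin d,
      ∃! i, ∀ j ∈ S, A i j = t j := by
  intro S hS t
  have eq_of_agree : ∀ i i', (∀ j ∈ S, A i j = A i' j) → i = i' := by
    intro i i' h
    by_contra hne
    have hle := hammingDist_le_of_agree h
    rw [Fintype.card_fin, hS] at hle
    have := hdist i i' hne
    omega
  let restrict : Fin (d ^ k') → (S → Fin d) := fun i j => A i j
  have hinj : Function.Injective restrict := fun i i' h =>
    eq_of_agree i i' fun j hj => congrFun h ⟨j, hj⟩
  have hbij : Function.Bijective restrict :=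
    (Fintype.bijective_iff_injective_and_card restrict).mpr ⟨hinj, by simp [hS]⟩
  obtain ⟨i, hi⟩ := hbij.surjective fun j => t j
  have hit : ∀ j ∈ S, A i j = t j := fun j hj => congrFun hi ⟨j, hj⟩
  exact ⟨i, hit, fun i' hi' => eq_of_agree i' i fun j hj => (hi' j hj).trans (hit j hj).symm⟩
end

section
/- Let d ≥ 1 and let A : Fin s → Fin N → Fin d be an array such that for all distinct rows i ≠ i', the number of coincidences N - hammingDist (A i) (A i') is at most k'. If N > k' * (d + 1) * d / 2, then s ≤ d. -/
/-- The number of coordinates where two tuples agree. -/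
theorem card_filter_eq_eq_sub_hammingDist {N d : ℕ} (x y : Fin N → Fin d) :
    (Finset.univ.filter fun c => x c = y c).card = N - hammingDist x y := by
  have h := Finset.card_filter_add_card_filter_not (s := (Finset.univ : Finset (Fin N)))
    (fun c => x c = y c)
  rw [Finset.card_univ, Fintype.card_fin] at h
  simp only [hammingDist, ne_eq]
  omega

/-- Among `d + 1` rows over `d` symbols, every column contains a coincidence, so pairwise
coincidence numbers bounded by `k` bound the number of columns. -/
theorem two_mul_le_of_coincidences_le {N d k : ℕ} (B : Fin (d + 1) → Fin N → Fin d)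
    (hB : ∀ i j, i ≠ j → N - hammingDist (B i) (B j) ≤ k) :
    N * 2 ≤ k * (d + 1) * d := by
  have key := Finset.card_mul_le_card_mul (s := (Finset.univ : Finset (Fin N)))
    (t := (Finset.univ : Finset (Fin (d + 1))).offDiag)
    (fun c p => B p.1 c = B p.2 c) (m := 2) (n := k) ?_ ?_
  · rw [Finset.offDiag_card, Finset.card_univ, Finset.card_univ, Fintype.card_fin,
      Fintype.card_fin, ← Nat.mul_sub_one, Nat.add_sub_cancel] at key
    linarith
  · intro c _
    obtain ⟨i, j, hij, h⟩ := Fintype.exists_ne_map_eq_of_card_lt (fun i => B i c) (by simp)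
    refine Finset.one_lt_card.2 ⟨(i, j), ?_, (j, i), ?_, ?_⟩
    · simpa [Finset.bipartiteAbove, hij] using h
    · simpa [Finset.bipartiteAbove, hij.symm] using h.symm
    · simp [hij]
  · rintro ⟨i, j⟩ h
    have hij : i ≠ j := by simpa using h
    simpa only [Finset.bipartiteBelow, card_filter_eq_eq_sub_hammingDist] using hB i j hij

theorem stmt_16 (N d s k' : ℕ) (hd : 1 ≤ d)
    (A : Fin s → Fin N → Fin d)
    (hco : ∀ i i' : Fin s, i ≠ i' → N - hammingDist (A i) (A i') ≤ k')
    (hN : k' * (d + 1) * d / 2 < N) :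
    s ≤ d := by
  by_contra! hs
  have h := two_mul_le_of_coincidences_le (fun i => A (Fin.castLE hs i))
    fun i j hij => hco _ _ fun h => hij (Fin.castLE_injective hs h)
  omega
end

section
/- Let d ≥ 1 and let A : Fin s → Fin N → Fin d be any array. Then, as an inequality of integers, 2 * d * (∑ over unordered pairs {i, i'} of distinct rows of (N - hammingDist (A i) (A i'))) ≥ N * s * (s - d). Consequently, if every pair of distinct rows has at most k' coincidences, then k' * s * (s - 1) * d ≥ N * s * (s - d). -/
/-- The number of coincidences of two tuples, as a sum of indicators. -/
lemma card_sub_hammingDist_eq_sum {ι α : Type*} [Fintype ι] [DecidableEq α] (x y : ι → α) :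
    (Fintype.card ι : ℤ) - hammingDist x y = ∑ j, if x j = y j then 1 else 0 := by
  have h := Finset.card_filter_add_card_filter_not (s := Finset.univ) (fun j => x j = y j)
  rw [Finset.sum_boole, hammingDist, ← Finset.card_univ, ← h]
  push_cast
  ring

/-- Splitting the sum of a symmetric function over all pairs into diagonal and strict pairs. -/
lemma sum_sum_eq_diag_add_two_mul_sum_lt {ι R : Type*} [Fintype ι] [LinearOrder ι]
    [CommSemiring R] (f : ι → ι → R) (hf : ∀ i j, f i j = f j i) :
    ∑ i, ∑ j, f i j = ∑ i, f i i +
      2 * ∑ p ∈ Finset.univ.filter (fun p : ι × ι => p.1 < p.2), f p.1 p.2 := by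
  have hsplit : ∀ i j, f i j =
      (if i = j then f i j else 0) + (if i < j then f i j else 0) +
        (if j < i then f j i else 0) := by
    intro i j
    rcases lt_trichotomy i j with h | h | h
    · simp [h, h.ne, h.not_gt]
    · simp [h]
    · simp [h, h.ne', h.not_gt, hf i j]
  rw [Finset.sum_filter, Fintype.sum_prod_type]
  calc ∑ i, ∑ j, f i j
      = ∑ i, ∑ j, ((if i = j then f i j else 0) + (if i < j then f i j else 0) +
        (if j < i then f j i else 0)) :=
        Finset.sum_congr rfl fun i _ => Finset.sum_congr rfl fun j _ => hsplit i j
    _ = _ := by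
        simp only [Finset.sum_add_distrib]
        rw [Finset.sum_comm (f := fun i j => if j < i then f j i else 0)]
        simp [two_mul, add_assoc]

/-- Among all ordered pairs, a map into a finite type has many coincidences. -/
lemma card_sq_le_card_mul_sum_coincidences {ι α : Type*} [Fintype ι] [Fintype α] [DecidableEq α]
    (g : ι → α) :
    (Fintype.card ι : ℤ) ^ 2 ≤
      Fintype.card α * ∑ i, ∑ i', if g i = g i' then (1 : ℤ) else 0 := by
  have hsum : ∑ v, ∑ i, (if g i = v then (1 : ℤ) else 0) = Fintype.card ι := by
    rw [Finset.sum_comm]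
    simp
  have hsq : ∑ v, (∑ i, if g i = v then (1 : ℤ) else 0) ^ 2 =
      ∑ i, ∑ i', if g i = g i' then (1 : ℤ) else 0 := by
    simp_rw [sq, Finset.sum_mul_sum]
    rw [Finset.sum_comm]
    refine Finset.sum_congr rfl fun i _ => ?_
    rw [Finset.sum_comm]
    refine Finset.sum_congr rfl fun i' _ => ?_
    simp [eq_comm]
  have h := sq_sum_le_card_mul_sum_sq (s := Finset.univ)
    (f := fun v => ∑ i, if g i = v then (1 : ℤ) else 0)
  rwa [hsum, hsq, Finset.card_univ] at h

theorem stmt_17 (N d s : ℕ) (hd : 1 ≤ d) (A : Fin s → Fin N → Fin d) :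
    (N : ℤ) * s * ((s : ℤ) - d) ≤ 2 * d *
      ∑ p ∈ Finset.univ.filter (fun p : Fin s × Fin s => p.1 < p.2),
        ((N : ℤ) - hammingDist (A p.1) (A p.2)) ∧
    ∀ k' : ℕ, (∀ i i' : Fin s, i ≠ i' → (N : ℤ) - hammingDist (A i) (A i') ≤ k') →
      (N : ℤ) * s * ((s : ℤ) - d) ≤ (k' : ℤ) * s * ((s : ℤ) - 1) * d := by
  have hpairs : (N : ℤ) * s * ((s : ℤ) - d) ≤ 2 * d *
      ∑ p ∈ Finset.univ.filter (fun p : Fin s × Fin s => p.1 < p.2),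
        ((N : ℤ) - hammingDist (A p.1) (A p.2)) := by
    have hsplit := sum_sum_eq_diag_add_two_mul_sum_lt
      (fun i i' => (N : ℤ) - hammingDist (A i) (A i'))
      (fun i i' => by rw [hammingDist_comm])
    have hall : ∑ i, ∑ i', ((N : ℤ) - hammingDist (A i) (A i')) =
        ∑ j, ∑ i, ∑ i', if A i j = A i' j then (1 : ℤ) else 0 := by
      have h (i i' : Fin s) := card_sub_hammingDist_eq_sum (A i) (A i')
      simp only [Fintype.card_fin] at h
      simp_rw [h]
      exact (Finset.sum_congr rfl fun i _ => Finset.sum_comm).trans Finset.sum_comm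
    have hcol : (N : ℤ) * (s : ℤ) ^ 2 ≤
        d * ∑ j, ∑ i, ∑ i', if A i j = A i' j then (1 : ℤ) else 0 := by
      rw [Finset.mul_sum]
      have h := Finset.sum_le_sum fun j (_ : j ∈ Finset.univ) =>
        card_sq_le_card_mul_sum_coincidences fun i => A i j
      simpa using h
    rw [← hall, hsplit] at hcol
    simp only [hammingDist_self, Nat.cast_zero, sub_zero, Finset.sum_const, Finset.card_univ,
      Fintype.card_fin, nsmul_eq_mul] at hcol
    linarith
  refine ⟨hpairs, fun k' hk => hpairs.trans ?_⟩
  have hle := Finset.sum_le_sum fun (p : Fin s × Fin s)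
    (hp : p ∈ Finset.univ.filter fun p : Fin s × Fin s => p.1 < p.2) =>
      hk p.1 p.2 (Finset.mem_filter.mp hp).2.ne
  have hconst := sum_sum_eq_diag_add_two_mul_sum_lt (fun _ _ : Fin s => (k' : ℤ))
    fun _ _ => rfl
  have hmul := mul_le_mul_of_nonneg_left hle (by positivity : (0 : ℤ) ≤ 2 * d)
  refine hmul.trans (le_of_eq ?_)
  rw [Finset.sum_const, Finset.sum_const, Finset.sum_const, Finset.card_univ, Fintype.card_fin,
    nsmul_eq_mul, nsmul_eq_mul] at hconst
  rw [Finset.sum_const]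
  linear_combination (-(d : ℤ)) * hconst
end
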